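/- Fix c₁, c₂ ∈ ℝ. Then lim_{σ → 1⁻} ℓ(c₁, c₂; σ) = 1 - Φ(max(c₁, c₂)) = 1 - max{Φ(c₁), Φ(c₂)}. -/

import Mathlib

open MeasureTheory Real Filter

/-- The standard normal probability density function. -/
noncomputable def stdPdf (x : ℝ) : ℝ := (Real.sqrt (2 * Real.pi))⁻¹ * Real.exp (-(x ^ 2) / 2)

/-- The standard normal cumulative distribution function. -/
noncomputable def stdCdf (x : ℝ) : ℝ := ∫ t in Set.Iic x, stdPdf t

/-- The upper bivariate normal tail probability for correlation `σ ∈ (-1,1)`. -/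
noncomputable def biTail (c₁ c₂ σ : ℝ) : ℝ :=
  (2 * Real.pi * Real.sqrt (1 - σ ^ 2))⁻¹ *
    ∫ x in Set.Ioi c₁, ∫ y in Set.Ioi c₂,
      Real.exp (-(x ^ 2 + y ^ 2 - 2 * σ * x * y) / (2 * (1 - σ ^ 2)))

lemma stdPdf_eq_gaussianPDFReal : stdPdf = ProbabilityTheory.gaussianPDFReal 0 1 := by
  ext x
  simp [stdPdf, ProbabilityTheory.gaussianPDFReal]

lemma integrable_stdPdf : Integrable stdPdf := by
  rw [stdPdf_eq_gaussianPDFReal]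
  exact ProbabilityTheory.integrable_gaussianPDFReal 0 1

lemma integral_stdPdf : ∫ x, stdPdf x = 1 := by
  rw [stdPdf_eq_gaussianPDFReal]
  exact ProbabilityTheory.integral_gaussianPDFReal_eq_one 0 one_ne_zero

lemma stdPdf_nonneg (x : ℝ) : 0 ≤ stdPdf x := by
  unfold stdPdf
  positivity

lemma stdCdf_eq_cdf (x : ℝ) :
    stdCdf x = ProbabilityTheory.cdf (ProbabilityTheory.gaussianReal 0 1) x := by
  rw [ProbabilityTheory.cdf_eq_real, Measure.real,
    ProbabilityTheory.gaussianReal_apply_eq_integral 0 one_ne_zero, ENNReal.toReal_ofReal, stdCdf,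
    stdPdf_eq_gaussianPDFReal]
  exact integral_nonneg fun t => ProbabilityTheory.gaussianPDFReal_nonneg 0 1 t

lemma monotone_stdCdf : Monotone stdCdf := by
  intro x y h
  simp only [stdCdf_eq_cdf]
  exact ProbabilityTheory.monotone_cdf _ h

lemma tendsto_stdCdf_atTop : Tendsto stdCdf atTop (nhds 1) := by
  rw [funext stdCdf_eq_cdf]
  exact ProbabilityTheory.tendsto_cdf_atTop _

lemma tendsto_stdCdf_atBot : Tendsto stdCdf atBot (nhds 0) := by
  rw [funext stdCdf_eq_cdf]
  exact ProbabilityTheory.tendsto_cdf_atBot _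

lemma stdCdf_nonneg (x : ℝ) : 0 ≤ stdCdf x := by
  rw [stdCdf_eq_cdf]
  exact ProbabilityTheory.cdf_nonneg _ x

lemma stdCdf_le_one (x : ℝ) : stdCdf x ≤ 1 := by
  rw [stdCdf_eq_cdf]
  exact ProbabilityTheory.cdf_le_one _ x

lemma setIntegral_Ioi_stdPdf (x : ℝ) : ∫ t in Set.Ioi x, stdPdf t = 1 - stdCdf x := by
  have h := integral_add_compl (measurableSet_Iic (a := x)) integrable_stdPdf
  rw [integral_stdPdf, Set.compl_Iic] at h
  rw [stdCdf]
  linarith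

lemma setIntegral_Ioi_comp_sub_div (g : ℝ → ℝ) (c d : ℝ) {s : ℝ} (hs : 0 < s) :
    ∫ y in Set.Ioi c, g ((y - d) / s) = s * ∫ t in Set.Ioi ((c - d) / s), g t := by
  rw [← integral_indicator measurableSet_Ioi, ← integral_indicator measurableSet_Ioi]
  have h (y : ℝ) : (Set.Ioi c).indicator (fun y => g ((y - d) / s)) y =
      (Set.Ioi ((c - d) / s)).indicator g ((y - d) / s) := by
    simp only [Set.indicator_apply, Set.mem_Ioi, div_lt_div_iff_of_pos_right hs,
      sub_lt_sub_iff_right]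
  simp_rw [h]
  rw [integral_sub_right_eq_self (fun y => (Set.Ioi ((c - d) / s)).indicator g (y / s)) d,
    Measure.integral_comp_div, abs_of_pos hs, smul_eq_mul]

/-- The bivariate tail as an integral of the conditional tail against the marginal density. -/
lemma biTail_eq_integral (c₁ c₂ : ℝ) {σ : ℝ} (hσ : 0 < 1 - σ ^ 2) :
    biTail c₁ c₂ σ =
      ∫ x in Set.Ioi c₁, stdPdf x * (1 - stdCdf ((c₂ - σ * x) / √(1 - σ ^ 2))) := by
  have hs : 0 < √(1 - σ ^ 2) := Real.sqrt_pos.2 hσ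
  have hsq : √(1 - σ ^ 2) ^ 2 = 1 - σ ^ 2 := Real.sq_sqrt hσ.le
  have hpi : √(2 * π) ^ 2 = 2 * π := Real.sq_sqrt (by positivity)
  have hexp (x y : ℝ) : Real.exp (-(x ^ 2 + y ^ 2 - 2 * σ * x * y) / (2 * (1 - σ ^ 2))) =
      2 * π * stdPdf x * stdPdf ((y - σ * x) / √(1 - σ ^ 2)) := by
    have : -(x ^ 2 + y ^ 2 - 2 * σ * x * y) / (2 * (1 - σ ^ 2)) =
        -(x ^ 2) / 2 + -(((y - σ * x) / √(1 - σ ^ 2)) ^ 2) / 2 := by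
      rw [div_pow, hsq]
      field_simp
      ring
    rw [this, Real.exp_add, stdPdf, stdPdf]
    field_simp
    rw [hpi]
  rw [biTail, ← integral_const_mul]
  congr 1 with x
  simp_rw [hexp]
  rw [integral_const_mul, setIntegral_Ioi_comp_sub_div stdPdf c₂ (σ * x) hs,
    setIntegral_Ioi_stdPdf]
  field_simp

/-- The conditional tail of the second coordinate degenerates to a step function as `σ → 1⁻`. -/
lemma tendsto_one_sub_stdCdf_conditional {c x : ℝ} (hx : x ≠ c) :
    Tendsto (fun σ : ℝ => 1 - stdCdf ((c - σ * x) / √(1 - σ ^ 2))) (nhdsWithin 1 (Set.Iio 1))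
      (nhds ((Set.Ioi c).indicator 1 x)) := by
  have hnum : Tendsto (fun σ : ℝ => c - σ * x) (nhdsWithin 1 (Set.Iio 1)) (nhds (c - x)) := by
    have : Continuous fun σ : ℝ => c - σ * x := by fun_prop
    simpa using (this.tendsto 1).mono_left nhdsWithin_le_nhds
  have hden : Tendsto (fun σ : ℝ => (√(1 - σ ^ 2))⁻¹) (nhdsWithin 1 (Set.Iio 1)) atTop := by
    refine Tendsto.inv_tendsto_nhdsGT_zero (tendsto_nhdsWithin_iff.2 ⟨?_, ?_⟩)
    · have : Continuous fun σ : ℝ => √(1 - σ ^ 2) := by fun_prop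
      simpa using (this.tendsto 1).mono_left nhdsWithin_le_nhds
    · filter_upwards [Ioo_mem_nhdsLT (zero_lt_one' ℝ)] with σ hσ
      exact Real.sqrt_pos.2 (by nlinarith [hσ.1, hσ.2])
  simp only [div_eq_mul_inv]
  rcases hx.lt_or_gt with h | h
  · have := tendsto_stdCdf_atTop.comp (hnum.pos_mul_atTop (sub_pos.2 h) hden)
    simpa [Set.indicator_apply, h.not_gt] using this.const_sub 1
  · have := tendsto_stdCdf_atBot.comp (hnum.neg_mul_atTop (sub_neg.2 h) hden)
    simpa [Set.indicator_apply, h] using this.const_sub 1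

/-- `lim_{σ → 1⁻} ℓ(c₁, c₂; σ) = 1 - Φ(max(c₁, c₂)) = 1 - max{Φ(c₁), Φ(c₂)}`. -/
theorem biTail_tendsto_one (c₁ c₂ : ℝ) :
    Tendsto (fun σ => biTail c₁ c₂ σ) (nhdsWithin 1 (Set.Iio 1))
        (nhds (1 - stdCdf (max c₁ c₂))) ∧
      1 - stdCdf (max c₁ c₂) = 1 - max (stdCdf c₁) (stdCdf c₂) := by
  refine ⟨?_, by rw [monotone_stdCdf.map_max]⟩
  have hlim : 1 - stdCdf (max c₁ c₂) =
      ∫ x in Set.Ioi c₁, stdPdf x * (Set.Ioi c₂).indicator 1 x := by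
    have h (x : ℝ) : stdPdf x * (Set.Ioi c₂).indicator 1 x = (Set.Ioi c₂).indicator stdPdf x := by
      simp [Set.indicator_apply]
    simp_rw [h]
    rw [setIntegral_indicator measurableSet_Ioi, Set.Ioi_inter_Ioi, setIntegral_Ioi_stdPdf]
  rw [hlim]
  have heq : (fun σ => ∫ x in Set.Ioi c₁,
      stdPdf x * (1 - stdCdf ((c₂ - σ * x) / √(1 - σ ^ 2)))) =ᶠ[nhdsWithin 1 (Set.Iio 1)]
      fun σ => biTail c₁ c₂ σ := by
    filter_upwards [Ioo_mem_nhdsLT (zero_lt_one' ℝ)] with σ hσ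
    exact (biTail_eq_integral c₁ c₂ (by nlinarith [hσ.1, hσ.2])).symm
  refine Tendsto.congr' heq (tendsto_integral_filter_of_dominated_convergence stdPdf
    (Eventually.of_forall fun σ => ?_) (Eventually.of_forall fun σ => ae_of_all _ fun x => ?_)
    integrable_stdPdf.restrict ?_)
  · have hcdf : Measurable fun x : ℝ => 1 - stdCdf ((c₂ - σ * x) / √(1 - σ ^ 2)) :=
      measurable_const.sub (monotone_stdCdf.measurable.comp (by fun_prop))
    exact integrable_stdPdf.restrict.aestronglyMeasurable.mul hcdf.aestronglyMeasurable
  · rw [Real.norm_eq_abs, abs_of_nonneg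
      (mul_nonneg (stdPdf_nonneg x) (sub_nonneg.2 (stdCdf_le_one _)))]
    exact mul_le_of_le_one_right (stdPdf_nonneg x) (sub_le_self _ (stdCdf_nonneg _))
  · filter_upwards [ae_restrict_of_ae (Measure.ae_ne volume c₂)] with x hx
    exact (tendsto_one_sub_stdCdf_conditional hx).const_mul _
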